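/- arXiv:1202.5759 — 4 statements merged into one kernel-verified Lean document; each statement's English description precedes it below -/
import Mathlib

section
/- Let R be a right hereditary ring (every right ideal of R is projective as a right R-module) and let H be a finite group which is without R-torsion, i.e. the order of H is invertible in R. Then the group ring R[H] is right hereditary: every right ideal of R[H] is projective as a right R[H]-module. -/
/-- A ring `R` is *right hereditary* if every right ideal of `R` (i.e. every
`Rᵐᵒᵖ`-submodule of `R`) is projective as a right `R`-module. -/
def RightHereditary (R : Type*) [Ring R] : Prop :=
  ∀ I : Submodule Rᵐᵒᵖ R, Module.Projective Rᵐᵒᵖ I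

/-- A module is projective if it admits a linear map with projective kernel and range. -/
theorem Module.Projective.of_ker_of_range {S N P : Type*} [Ring S] [AddCommGroup N] [Module S N]
    [AddCommGroup P] [Module S P] (f : N →ₗ[S] P) [Module.Projective S (LinearMap.ker f)]
    [Module.Projective S (LinearMap.range f)] : Module.Projective S N := by
  obtain ⟨s, hs⟩ := Module.projective_lifting_property f.rangeRestrict LinearMap.id
    f.surjective_rangeRestrict
  have hfs (y : LinearMap.range f) : f (s y) = y :=
    congrArg Subtype.val (LinearMap.congr_fun hs y)
  have hker (x : N) : (LinearMap.id - s ∘ₗ f.rangeRestrict : N →ₗ[S] N) x ∈ LinearMap.ker f := by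
    simp [hfs]
  refine Module.Projective.of_split
    ((LinearMap.codRestrict (LinearMap.ker f) _ hker).prod f.rangeRestrict)
    ((LinearMap.ker f).subtype.coprod s) ?_
  ext x
  simp

/-- If all submodules of `M` are projective, then so is every module embedding in `Fin n → M`. -/
theorem Module.Projective.of_injective_pi_fin {S M : Type*} [Ring S] [AddCommGroup M] [Module S M]
    (hM : ∀ K : Submodule S M, Module.Projective S K) (n : ℕ) {N : Type*} [AddCommGroup N]
    [Module S N] (f : N →ₗ[S] (Fin n → M)) (hf : Function.Injective f) :
    Module.Projective S N := by
  induction n generalizing N with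
  | zero =>
    have := hf.subsingleton
    infer_instance
  | succ n ih =>
    let g : N →ₗ[S] M := LinearMap.proj 0 ∘ₗ f
    have : Module.Projective S (LinearMap.range g) := hM _
    have : Module.Projective S (LinearMap.ker g) := by
      refine ih (LinearMap.funLeft S M Fin.succ ∘ₗ f ∘ₗ (LinearMap.ker g).subtype) ?_
      intro x y hxy
      refine Subtype.ext (hf (funext fun i => ?_))
      induction i using Fin.cases with
      | zero => exact (LinearMap.mem_ker.mp x.2).trans (LinearMap.mem_ker.mp y.2).symm
      | succ i => exact congrFun hxy i
    exact Module.Projective.of_ker_of_range g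

/-- If all submodules of `M` are projective, then so is every module embedding in a finite
power of `M`. -/
theorem Module.Projective.of_injective_pi {S M ι : Type*} [Ring S] [AddCommGroup M] [Module S M]
    [Finite ι] (hM : ∀ K : Submodule S M, Module.Projective S K) {N : Type*} [AddCommGroup N]
    [Module S N] (f : N →ₗ[S] (ι → M)) (hf : Function.Injective f) : Module.Projective S N := by
  obtain ⟨n, ⟨e⟩⟩ := Finite.exists_equiv_fin ι
  exact .of_injective_pi_fin hM n ((LinearEquiv.funCongrLeft S M e.symm).toLinearMap ∘ₗ f)
    ((LinearEquiv.funCongrLeft S M e.symm).injective.comp hf)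

/-- Averaging over a finite group: let `A` be additively generated by the products `φ s * ψ h`,
where `φ : S →+* A` and `ψ : H →* A` have commuting images and `|H|` is invertible in `S`.
Then an `A`-module whose restriction along `φ` is projective is itself projective. -/
theorem Module.Projective.of_compHom_of_isUnit_card {S A H M : Type*} [Ring S] [Ring A] [Group H]
    [Fintype H] [AddCommGroup M] [Module A M] (φ : S →+* A) (ψ : H →* A)
    (hcomm : ∀ s h, Commute (φ s) (ψ h))
    (hgen : AddSubmonoid.closure {a | ∃ s h, a = φ s * ψ h} = ⊤)
    (hcard : IsUnit ((Fintype.card H : ℕ) : S))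
    (hM : @Module.Projective S _ M _ (Module.compHom M φ)) : Module.Projective A M := by
  refine Module.Projective.of_lifting_property'' fun f hf => ?_
  let : Module S M := Module.compHom M φ
  let : Module S (M →₀ A) := Module.compHom (M →₀ A) φ
  let fS : (M →₀ A) →ₗ[S] M := { f.toAddMonoidHom with map_smul' := fun s x => f.map_smul (φ s) x }
  obtain ⟨s, hs⟩ := Module.projective_lifting_property fS LinearMap.id hf
  have hfs (m : M) : f (s m) = m := LinearMap.congr_fun hs m
  have hsφ (r : S) (m : M) : s (φ r • m) = φ r • s m := s.map_smul r m
  obtain ⟨c, hc⟩ := hcard.exists_right_inv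
  have hc' : φ c * (Fintype.card H : A) = 1 := by
    rw [← map_natCast φ, ← map_mul, ← (Nat.cast_commute _ c).eq, hc, map_one]
  have hcS (r : S) : Commute c r := by
    have hu : Commute (Fintype.card H : S) r := Nat.cast_commute _ r
    have hc2 : c * (Fintype.card H : S) = 1 := by rw [← (Nat.cast_commute _ c).eq, hc]
    calc c * r = c * (r * ((Fintype.card H : S) * c)) := by rw [hc, mul_one]
      _ = (c * (Fintype.card H : S)) * r * c := by
        rw [← mul_assoc r, ← hu.eq]; simp only [mul_assoc]
      _ = r * c := by rw [hc2, one_mul]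
  let t : M →+ (M →₀ A) :=
    { toFun := fun m => φ c • ∑ h : H, ψ h⁻¹ • s (ψ h • m)
      map_zero' := by simp
      map_add' := fun x y => by simp [Finset.sum_add_distrib] }
  have ht (m : M) : t m = φ c • ∑ h : H, ψ h⁻¹ • s (ψ h • m) := rfl
  have htφ (r : S) (m : M) : t (φ r • m) = φ r • t m := by
    rw [ht, ht, smul_smul, ← map_mul, ← (hcS r).eq, map_mul, ← smul_smul, Finset.smul_sum (r := φ r)]
    refine congrArg _ (Finset.sum_congr rfl fun h _ => ?_)
    rw [smul_smul, ← (hcomm r h).eq, ← smul_smul, hsφ, smul_smul, smul_smul, (hcomm r h⁻¹).eq]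
  have htψ (k : H) (m : M) : t (ψ k • m) = ψ k • t m := by
    rw [ht, ht, smul_smul, ← (hcomm c k).eq, ← smul_smul, Finset.smul_sum (r := ψ k)]
    refine congrArg _ (Fintype.sum_equiv (Equiv.mulRight k) _ _ fun h => ?_)
    simp [smul_smul, ← map_mul]
  refine ⟨{ t with map_smul' := fun a m => ?_ }, ?_⟩
  · change t (a • m) = a • t m
    have ha : a ∈ AddSubmonoid.closure {a | ∃ s h, a = φ s * ψ h} := hgen ▸ AddSubmonoid.mem_top a
    induction ha using AddSubmonoid.closure_induction with
    | mem a ha =>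
      obtain ⟨r, h, rfl⟩ := ha
      rw [← smul_smul, htφ, htψ, smul_smul]
    | zero => simp
    | add a b _ _ iha ihb => rw [add_smul, map_add, iha, ihb, add_smul]
  · ext m
    change f (t m) = m
    simp only [ht, map_smul, map_sum, hfs, smul_smul, ← map_mul]
    simp [← Nat.cast_smul_eq_nsmul A, smul_smul, hc']

/-- Cliff–Weiss: if `R` is right hereditary and `H` is a finite group whose order is
invertible in `R`, then the group ring `R[H]` is right hereditary. -/
theorem rightHereditary_monoidAlgebra_of_rightHereditary
    (R : Type*) [Ring R] (H : Type*) [Group H] [Fintype H]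
    (hR : RightHereditary R) (hH : IsUnit ((Fintype.card H : ℕ) : R)) :
    RightHereditary (MonoidAlgebra R H) := by
  intro I
  let φ : Rᵐᵒᵖ →+* (MonoidAlgebra R H)ᵐᵒᵖ := MonoidAlgebra.singleOneRingHom.op
  let ψ : H →* (MonoidAlgebra R H)ᵐᵒᵖ :=
    (MonoidAlgebra.of R H).op.comp (MulEquiv.inv' H).toMonoidHom
  refine Module.Projective.of_compHom_of_isUnit_card φ ψ (fun r h => ?_) ?_ ?_ ?_
  · apply MulOpposite.unop_injective
    simp [φ, ψ, MonoidAlgebra.single_mul_single]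
  · refine eq_top_iff.mpr fun a _ => ?_
    induction a using MulOpposite.rec' with | _ a => ?_
    induction a using MonoidAlgebra.induction_linear with
    | zero => exact zero_mem _
    | add a b ha hb => exact add_mem (ha trivial) (hb trivial)
    | single h r =>
      refine AddSubmonoid.subset_closure ⟨MulOpposite.op r, h⁻¹, MulOpposite.unop_injective ?_⟩
      simp [φ, ψ, MonoidAlgebra.single_mul_single]
  · simpa using hH.op
  · let : Module Rᵐᵒᵖ I := Module.compHom I φ
    let f : I →ₗ[Rᵐᵒᵖ] (H → R) :=
      { toFun := fun x h => (x : MonoidAlgebra R H).coeff h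
        map_add' := fun x y => by ext; simp
        map_smul' := fun r x => by
          ext h
          change ((x : MonoidAlgebra R H) * MonoidAlgebra.single 1 r.unop).coeff h = _
          simp }
    exact .of_injective_pi hR f fun x y hxy =>
      Subtype.ext (MonoidAlgebra.ext (Finsupp.ext fun h => congrFun hxy h))
end

section
/- Let R be a Dedekind domain and G a finite group whose order is invertible in R. Then the group ring R[G] is hereditary: every (left) ideal of R[G], i.e. every R[G]-submodule of R[G], is projective as an R[G]-module. -/
namespace LinearMap

variable {k : Type*} [CommRing k] {G : Type*} [Group G]
variable {V : Type*} [AddCommGroup V] [Module k V] [Module (MonoidAlgebra k G) V]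
  [IsScalarTower k (MonoidAlgebra k G) V]
variable {W : Type*} [AddCommGroup W] [Module k W] [Module (MonoidAlgebra k G) W]
  [IsScalarTower k (MonoidAlgebra k G) W]

/-- Conjugating a `k`-linear section of a `k[G]`-linear map yields another section. -/
theorem apply_conjugate_of_section (p : V →ₗ[MonoidAlgebra k G] W) (s : W →ₗ[k] V)
    (h : ∀ w, p (s w) = w) (g : G) (w : W) : p (s.conjugate g w) = w := by
  rw [conjugate_apply, p.map_smul, h, ← mul_smul, MonoidAlgebra.single_mul_single, mul_one,
    inv_mul_cancel, ← MonoidAlgebra.one_def, one_smul]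

/-- Averaging a `k`-linear section of a `k[G]`-linear map yields a `k[G]`-linear section. -/
theorem apply_equivariantProjection_of_section [Fintype G] (hcard : IsUnit (Nat.card G : k))
    (p : V →ₗ[MonoidAlgebra k G] W) (s : W →ₗ[k] V) (h : ∀ w, p (s w) = w) (w : W) :
    p (s.equivariantProjection G w) = w := by
  rw [equivariantProjection_apply, ← algebraMap_smul (MonoidAlgebra k G), p.map_smul, map_sum]
  simp only [apply_conjugate_of_section p s h]
  rw [algebraMap_smul, Finset.sum_const, Finset.card_univ, ← Nat.cast_smul_eq_nsmul k, smul_smul,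
    Fintype.card_eq_nat_card, Ring.inverse_mul_cancel _ hcard, one_smul]

end LinearMap

/-- If the order of the finite group `G` is invertible in `k`, then every `k[G]`-module which is
projective over `k` is projective over `k[G]`. -/
theorem Module.Projective.monoidAlgebra_of_isUnit_card {k : Type*} [CommRing k] {G : Type*}
    [Group G] [Fintype G] (hcard : IsUnit (Nat.card G : k)) (M : Type*) [AddCommGroup M]
    [Module k M] [Module (MonoidAlgebra k G) M] [IsScalarTower k (MonoidAlgebra k G) M]
    [Module.Projective k M] : Module.Projective (MonoidAlgebra k G) M := by
  refine .of_lifting_property'' fun p hp ↦ ?_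
  obtain ⟨s, hs⟩ := Module.projective_lifting_property (p.restrictScalars k) .id hp
  exact ⟨s.equivariantProjection G, LinearMap.ext <|
    LinearMap.apply_equivariantProjection_of_section hcard p s (LinearMap.congr_fun hs)⟩

/-- A finite torsion-free module over a Dedekind domain is projective. -/
theorem IsDedekindDomain.projective_of_isTorsionFree (R : Type*) [CommRing R]
    [IsDedekindDomain R] (M : Type*) [AddCommGroup M] [Module R M] [Module.Finite R M]
    [Module.IsTorsionFree R M] : Module.Projective R M :=
  have := Module.finitePresentation_of_finite R M
  Module.Flat.projective_of_finitePresentation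


/-- If `R` is a Dedekind domain and `G` is a finite group whose order is invertible in
`R`, then the group ring `R[G]` is hereditary: every (left) ideal of `R[G]`, i.e. every
`R[G]`-submodule of `R[G]`, is projective as an `R[G]`-module. -/
theorem monoidAlgebra_hereditary_of_isDedekindDomain
    (R : Type*) [CommRing R] [IsDomain R] [IsDedekindDomain R]
    (G : Type*) [Group G] [Fintype G] (hG : IsUnit ((Fintype.card G : ℕ) : R)) :
    ∀ I : Submodule (MonoidAlgebra R G) (MonoidAlgebra R G),
      Module.Projective (MonoidAlgebra R G) I := by
  intro I
  have : Module.IsTorsionFree R I :=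
    inferInstanceAs (Module.IsTorsionFree R (I.restrictScalars R))
  have : Module.Finite R I := inferInstanceAs (Module.Finite R (I.restrictScalars R))
  have := IsDedekindDomain.projective_of_isTorsionFree R I
  exact .monoidAlgebra_of_isUnit_card (by rwa [Nat.card_eq_fintype_card]) I
end

section
/- Let H, A, B be finite groups together with injective group homomorphisms i₁ : H → A and i₂ : H → B, and let G = A *_H B be the amalgamated free product (the pushout of A ← H → B in the category of groups). Then G has a free subgroup of finite index: there exists a subgroup F of G of finite index such that F is a free group. -/
universe u

/-- The vertex groups of an amalgam of two groups, as a family indexed by `Bool`. -/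
def AmalgamFam (A B : Type u) : Bool → Type u
  | true => A
  | false => B

instance (A B : Type u) [Group A] [Group B] : ∀ b, Group (AmalgamFam A B b)
  | true => inferInstanceAs (Group A)
  | false => inferInstanceAs (Group B)

/-- The structure maps of the amalgam `A *_H B`. -/
def amalgamMaps {H : Type*} {A B : Type u} [Group H] [Group A] [Group B]
    (i₁ : H →* A) (i₂ : H →* B) : ∀ b, H →* AmalgamFam A B b
  | true => show H →* A from i₁
  | false => show H →* B from i₂

open CategoryTheory CategoryTheory.ActionCategory Monoid

/-- An injective homomorphism `φ : H → K` admits an `H`-equivariant retraction of the left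
`H`-set `K` onto `H`. -/
theorem exists_equivariant_retraction {H K : Type*} [Group H] [Group K] {φ : H →* K}
    (hφ : Function.Injective φ) :
    ∃ τ : K → H, τ 1 = 1 ∧ ∀ h k, τ (φ h * k) = h * τ k := by
  obtain ⟨S, hS, hS1⟩ := φ.range.exists_isComplement_right 1
  let e := (MonoidHom.ofInjective hφ).symm
  refine ⟨fun k => e (hS.equiv k).1, ?_, fun h k => ?_⟩
  · dsimp only
    rw [hS.equiv_one φ.range.one_mem hS1]
    exact map_one e
  · have := hS.equiv_mul_left (MonoidHom.ofInjective hφ h) k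
    rw [MonoidHom.ofInjective_apply] at this
    dsimp only
    rw [this, map_mul, MulEquiv.symm_apply_apply]

theorem SemidirectProduct.left_mul_mulAutArrow {G Q X : Type*} [Group G] [MulAction G Q] [Group X]
    (x y : (Q → X) ⋊[mulAutArrow] G) (q : Q) :
    (x * y).left q = x.left q * y.left (x.right⁻¹ • q) :=
  rfl

namespace Monoid.PushoutI

section FreeAction

variable {ι : Type*} {K : ι → Type*} {H : Type*} [∀ i, Group (K i)] [Group H]
  {φ : ∀ i, H →* K i} {Q : Type*} [MulAction (PushoutI φ) Q]

/-- A pair `(i, q)` indexes a generating arrow of the action groupoid of an amalgam on `Q`,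
namely the arrow with target `q` given by `t i q ∈ K i`, if this arrow is not an identity and,
for `i` other than the distinguished index `o`, if `q` is the chosen representative of its
`H`-orbit. -/
def IsGenerator (τ : ∀ i, K i → H) (t : ∀ i, Q → K i) (o i : ι) (q : Q) : Prop :=
  t i q ≠ 1 ∧ (i ≠ o → τ i (t i q) = 1)

variable {τ : ∀ i, K i → H} {t : ∀ i, Q → K i} (o : ι)

/-- Values on the generating arrows extend to a crossed homomorphism on the amalgam. -/
theorem exists_crossedHom (hτ_one : ∀ i, τ i 1 = 1)
    (hτ : ∀ i h k, τ i (φ i h * k) = h * τ i k)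
    (ht : ∀ i k q, t i (of (φ := φ) i k • q) = k * t i q)
    {X : Type*} [Group X] (a : ι → Q → X)
    (ha : ∀ i q, ¬ IsGenerator τ t o i q → a i q = 1) :
    ∃ F : PushoutI φ →* (Q → X) ⋊[mulAutArrow] PushoutI φ,
      (∀ g, (F g).right = g) ∧
      ∀ i q, IsGenerator τ t o i q → (F (of i (t i q))).left q = a i q := by
  let s (i : ι) (q : Q) : Q := (base φ (τ i (t i q)))⁻¹ • q
  let α (i : ι) (q : Q) : X := a o q * (a o (s i q))⁻¹ * a i (s i q)
  have htb (i h q) : t i (base φ h • q) = φ i h * t i q := by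
    rw [← of_apply_eq_base φ i, ht]
  have hs (i h q) : s i (base φ h • q) = s i q := by
    simp only [s, htb, hτ, map_mul, mul_inv_rev, mul_smul, inv_smul_smul]
  let f (i : ι) : K i →* (Q → X) ⋊[mulAutArrow] PushoutI φ :=
    (MulAut.conj (SemidirectProduct.inl (α i))).toMonoidHom.comp
      (SemidirectProduct.inr.comp (of i))
  have f_left (i k q) : (f i k).left q = α i q * (α i ((of (φ := φ) i k)⁻¹ • q))⁻¹ := by
    simp [f, MulAut.conj_apply, SemidirectProduct.left_mul_mulAutArrow, ← map_inv]
  have f_right (i k) : (f i k).right = of i k := by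
    simp [f, MulAut.conj_apply]
  have hf (i) : (f i).comp (φ i) = (f o).comp (φ o) := by
    ext h q
    · simp only [MonoidHom.comp_apply, f_left, of_apply_eq_base, ← map_inv]
      simp only [α, hs]
      group
    · simp only [MonoidHom.comp_apply, f_right, of_apply_eq_base]
  let F := lift f ((f o).comp (φ o)) hf
  refine ⟨F, ?_, fun i q hq => ?_⟩
  · have : SemidirectProduct.rightHom.comp F = MonoidHom.id _ := by
      refine hom_ext (fun i => ?_) ?_
      · ext k
        simp [F, f_right]
      · ext h
        simp [F, f_right, of_apply_eq_base]
    exact DFunLike.ext_iff.mp this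
  · have hr : t i ((of (φ := φ) i (t i q))⁻¹ • q) = 1 := by rw [← map_inv, ht, inv_mul_cancel]
    have hα : α i ((of (φ := φ) i (t i q))⁻¹ • q) = 1 := by
      have hsr : s i ((of (φ := φ) i (t i q))⁻¹ • q) = (of (φ := φ) i (t i q))⁻¹ • q := by
        simp only [s, hr, hτ_one, map_one, inv_one, one_smul]
      simp only [α, hsr]
      rw [ha i _ fun h => h.1 hr]
      group
    simp only [F, lift_of, f_left, hα, inv_one, mul_one]
    by_cases hi : i = o
    · subst hi
      simp [α]
    · have : s i q = q := by simp [s, hq.2 hi]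
      simp [α, this]

/-- A crossed homomorphism on the amalgam is determined by its values on the generating arrows. -/
theorem crossedHom_ext
    (hτ : ∀ i h k, τ i (φ i h * k) = h * τ i k)
    (ht : ∀ i k q, t i (of (φ := φ) i k • q) = k * t i q)
    {X : Type*} [Group X]
    {F F' : PushoutI φ →* (Q → X) ⋊[mulAutArrow] PushoutI φ}
    (hF : ∀ g, (F g).right = g) (hF' : ∀ g, (F' g).right = g)
    (h : ∀ i q, IsGenerator τ t o i q →
      (F (of i (t i q))).left q = (F' (of i (t i q))).left q) :
    F = F' := by
  have key (i) (hi : ∀ q, (F (of i (t i q))).left q = (F' (of i (t i q))).left q) (k) :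
      F (of i k) = F' (of i k) := by
    refine SemidirectProduct.ext (funext fun q => ?_) (by rw [hF, hF'])
    have hq : t i q = k * t i ((of (φ := φ) i k)⁻¹ • q) := by rw [← map_inv, ht, mul_inv_cancel_left]
    have := hi q
    rw [hq, map_mul, map_mul, map_mul, SemidirectProduct.left_mul_mulAutArrow,
      SemidirectProduct.left_mul_mulAutArrow, hF, hF', hi] at this
    exact mul_right_cancel this
  have gen (i q) (hq : i ≠ o → τ i (t i q) = 1) :
      (F (of i (t i q))).left q = (F' (of i (t i q))).left q := by
    by_cases h1 : t i q = 1
    · simp [h1]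
    · exact h i q ⟨h1, hq⟩
  have hbase (x : H) : F (base φ x) = F' (base φ x) := by
    rw [← of_apply_eq_base φ o]
    exact key o (fun q => gen o q fun ho => absurd rfl ho) _
  refine hom_ext (fun i => ?_) (MonoidHom.ext hbase)
  refine MonoidHom.ext fun k => key i (fun q => ?_) k
  set x := τ i (t i q) with hx
  have hs : t i ((base φ x)⁻¹ • q) = (φ i x)⁻¹ * t i q := by
    rw [← of_apply_eq_base φ i, ← map_inv, ht]
  have hq : of i (t i q) = base φ x * of i (t i ((base φ x)⁻¹ • q)) := by
    rw [← of_apply_eq_base φ i, ← map_mul, of_apply_eq_base φ i, hs, mul_inv_cancel_left]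
  rw [hq, map_mul, map_mul, SemidirectProduct.left_mul_mulAutArrow,
    SemidirectProduct.left_mul_mulAutArrow, hF, hF', hbase, gen i _ fun _ => ?_]
  rw [hs, ← map_inv, hτ, ← hx, inv_mul_cancel]

end FreeAction

universe v w x

variable {ι : Type u} {K : ι → Type v} {H : Type w} [∀ i, Group (K i)] [Group H]
  {φ : ∀ i, H →* K i}

/-- The action groupoid of an amalgam on a set on which each factor acts freely (as witnessed by
equivariant maps to the factors) is free. -/
theorem nonempty_isFreeGroupoid_actionCategory [Nonempty ι]
    (hφ : ∀ i, Function.Injective (φ i)) {Q : Type x}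
    [MulAction (PushoutI φ) Q] (t : ∀ i, Q → K i)
    (ht : ∀ i k q, t i (of (φ := φ) i k • q) = k * t i q) :
    Nonempty (IsFreeGroupoid (ActionCategory (PushoutI φ) Q)) := by
  classical
  obtain ⟨o⟩ := ‹Nonempty ι›
  choose τ hτ_one hτ using fun i => exists_equivariant_retraction (hφ i)
  refine ⟨{
    quiverGenerators := ⟨fun a b => {i : ULift.{max v w} ι //
      IsGenerator τ t o i.down b.back ∧ of (φ := φ) i.down (t i.down b.back) • a.back = b.back}⟩
    of := fun e => ⟨of e.1.down (t e.1.down _), e.2.2⟩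
    unique_lift := ?_ }⟩
  intro X _ f
  let a (i : ι) (q : Q) : X := if h : IsGenerator τ t o i q then
    @f ⟨(), (of i (t i q))⁻¹ • q⟩ ⟨(), q⟩ ⟨⟨i⟩, h, smul_inv_smul _ q⟩ else 1
  obtain ⟨F, hF, hFa⟩ := exists_crossedHom o hτ_one hτ ht a fun i q h => dif_neg h
  refine ⟨uncurry F hF, ?_, fun E hE => ?_⟩
  · rintro ⟨⟨⟩, p : Q⟩ ⟨⟨⟩, q : Q⟩ ⟨⟨i⟩, hi, h : of i (t i q) • p = q⟩
    change (F (of i (t i q))).left q = _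
    rw [hFa i q hi]
    cases inv_smul_eq_iff.mpr h.symm
    exact dif_pos hi
  · have : curry E = F := by
      refine crossedHom_ext o hτ ht (fun _ => rfl) hF fun i q hq => ?_
      rw [hFa i q hq]
      refine Eq.trans ?_ (dif_pos hq).symm
      exact hE ⟨(), (of i (t i q))⁻¹ • q⟩ ⟨(), q⟩ ⟨⟨i⟩, hq, smul_inv_smul _ q⟩
    apply Functor.hext
    · intro
      apply Unit.ext
    · refine ActionCategory.cases ?_
      intro q g
      exact heq_of_eq (congrArg (fun F' => (F' g).left q) this)

/-- A subgroup of an amalgam is free if each factor acts freely on its cosets. -/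
theorem isFreeGroup_of_equivariant [Nonempty ι] (hφ : ∀ i, Function.Injective (φ i))
    (F : Subgroup (PushoutI φ)) (t : ∀ i, PushoutI φ ⧸ F → K i)
    (ht : ∀ i k q, t i (of (φ := φ) i k • q) = k * t i q) : IsFreeGroup F := by
  obtain ⟨_⟩ := nonempty_isFreeGroupoid_actionCategory hφ t ht
  let C := ActionCategory (PushoutI φ) (PushoutI φ ⧸ F)
  let r : C := objEquiv (PushoutI φ) (PushoutI φ ⧸ F) ((1 : PushoutI φ) : PushoutI φ ⧸ F)
  have hC : @IsConnected C Groupoid.toCategory :=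
    inferInstanceAs (IsConnected (ActionCategory (PushoutI φ) (PushoutI φ ⧸ F)))
  have hr := @IsFreeGroupoid.endIsFreeOfConnectedFree C _ hC _ r
  exact @IsFreeGroup.ofMulEquiv _ _ hr _ _ (endMulEquivSubgroup F)

/-- An amalgam of finitely many finite groups acts on a nonempty finite set such that each factor
acts freely. -/
theorem exists_finite_equivariant [Finite ι] [Finite H] [∀ i, Finite (K i)]
    (hφ : ∀ i, Function.Injective (φ i)) :
    ∃ (Y : Type (max u v w)) (_ : Finite Y) (_ : Nonempty Y) (_ : MulAction (PushoutI φ) Y)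
      (t : ∀ i, Y → K i), ∀ i k y, t i (of (φ := φ) i k • y) = k * t i y := by
  classical
  choose τ hτ_one hτ using fun i => exists_equivariant_retraction (hφ i)
  let Y := H × ∀ i, {k : K i // τ i k = 1}
  let t (i : ι) (y : Y) : K i := φ i y.1 * y.2 i
  let r (i : ι) (k : K i) : {k : K i // τ i k = 1} :=
    ⟨(φ i (τ i k))⁻¹ * k, by rw [← map_inv, hτ, inv_mul_cancel]⟩
  let m (i : ι) (k : K i) (y : Y) : Y := (τ i k, Function.update y.2 i (r i k))
  have t_m (i k y) : t i (m i k y) = k := by simp [t, m, r]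
  have m_m (i k k' y) : m i k (m i k' y) = m i k y := by simp [m]
  have m_base (i h) (y : Y) : m i (φ i h * t i y) y = (h * y.1, y.2) := by
    have h1 : τ i (φ i h * t i y) = h * y.1 := by simp [t, hτ, (y.2 i).2]
    have h2 : r i (φ i h * t i y) = y.2 i := by
      ext
      simp [r, h1, t, mul_assoc]
    simp only [m, h1, h2, Function.update_eq_self]
  let act (i : ι) : MulAction (K i) Y :=
    { smul := fun k y => m i (k * t i y) y
      one_smul := fun y => by
        change m i (1 * t i y) y = y
        simpa using m_base i 1 y
      mul_smul := fun k k' y => by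
        change m i (k * k' * t i y) y = m i (k * t i (m i (k' * t i y) y)) (m i (k' * t i y) y)
        rw [t_m, m_m, mul_assoc] }
  let ρ (i : ι) : K i →* Equiv.Perm Y := @MulAction.toPermHom (K i) Y _ (act i)
  let ρH : H →* Equiv.Perm Y :=
    { toFun := fun h => (Equiv.mulLeft h).prodCongr (Equiv.refl _)
      map_one' := by ext <;> simp
      map_mul' := fun _ _ => by ext <;> simp [mul_assoc] }
  have hρ (i) : (ρ i).comp (φ i) = ρH :=
    MonoidHom.ext fun h => Equiv.ext fun y => m_base i h y
  refine ⟨ULift.{max u v w} Y, inferInstance, ⟨⟨1, fun i => ⟨1, hτ_one i⟩⟩⟩,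
    MulAction.compHom _ ((Equiv.ulift (α := Y)).symm.permCongrHom.toMonoidHom.comp
      (lift ρ ρH hρ)), fun i y => t i y.down, fun i k y => ?_⟩
  change t i (lift ρ ρH hρ (of i k) y.down) = _
  rw [lift_of]
  exact t_m i _ _

/-- An amalgam of finitely many finite groups has a free subgroup of finite index. -/
theorem exists_isFreeGroup_index_ne_zero [Nonempty ι] [Finite ι] [Finite H] [∀ i, Finite (K i)]
    (hφ : ∀ i, Function.Injective (φ i)) :
    ∃ F : Subgroup (PushoutI φ), F.index ≠ 0 ∧ IsFreeGroup F := by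
  obtain ⟨Y, _, ⟨y⟩, _, t, ht⟩ := exists_finite_equivariant hφ
  have : Finite (PushoutI φ ⧸ MulAction.stabilizer (PushoutI φ) y) :=
    Finite.of_injective _ (MulAction.injective_ofQuotientStabilizer _ y)
  refine ⟨MulAction.stabilizer _ y, Subgroup.index_ne_zero_of_finite,
    isFreeGroup_of_equivariant hφ _
      (fun i q => t i (MulAction.ofQuotientStabilizer _ y q)) fun i k q => ?_⟩
  rw [MulAction.ofQuotientStabilizer_smul, ht]

end Monoid.PushoutI

/-- An amalgamated free product `G = A *_H B` of finite groups `A`, `B` along injective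
homomorphisms `i₁ : H → A`, `i₂ : H → B` has a free subgroup of finite index. -/
theorem amalgam_of_finite_groups_has_free_subgroup_of_finite_index
    (H : Type*) (A B : Type u) [Group H] [Group A] [Group B]
    [Finite H] [Finite A] [Finite B]
    (i₁ : H →* A) (i₂ : H →* B)
    (h₁ : Function.Injective i₁) (h₂ : Function.Injective i₂) :
    ∃ F : Subgroup (Monoid.PushoutI (amalgamMaps i₁ i₂)),
      F.index ≠ 0 ∧ IsFreeGroup F := by
  have (b : Bool) : Finite (AmalgamFam A B b) := by
    cases b
    · exact inferInstanceAs (Finite B)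
    · exact inferInstanceAs (Finite A)
  refine Monoid.PushoutI.exists_isFreeGroup_index_ne_zero fun b => ?_
  cases b
  · exact h₂
  · exact h₁
end

section
/- Let A be a finite group, let H₁ and H₂ be subgroups of A, and let φ : H₁ → H₂ be a group isomorphism. Let G = ⟨A, t | t h t⁻¹ = φ(h) for all h ∈ H₁⟩ be the associated HNN extension. Then G has a free subgroup of finite index: there exists a subgroup F of G of finite index such that F is a free group. -/
namespace HNNExtension

variable {A : Type*} [Group A] {H₁ H₂ : Subgroup A} {φ : H₁ ≃* H₂}

/-- In a finite group, an isomorphism between two subgroups is intertwined with itself by some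
permutation of the group, the subgroups acting by left multiplication. -/
theorem exists_perm_mul_eq_mul [Finite A] (φ : H₁ ≃* H₂) :
    ∃ τ : Equiv.Perm A, ∀ (h : H₁) (x : A), τ (h * x) = φ h * τ x := by
  have hcard : Nat.card (A ⧸ H₁) = Nat.card (A ⧸ H₂) := by
    have h := H₁.card_mul_index.trans H₂.card_mul_index.symm
    rw [Nat.card_congr φ.toEquiv] at h
    exact Nat.eq_of_mul_eq_mul_left Nat.card_pos h
  obtain ⟨e⟩ := Finite.card_eq.1 hcard
  let r (x : A) : H₁ :=
    ⟨(x : A ⧸ H₁).out⁻¹ * x, QuotientGroup.eq.1 (QuotientGroup.out_eq' (x : A ⧸ H₁))⟩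
  let σ (x : A) : A := (e x).out * φ (r x)
  have hσ (x : A) (h : H₁) : σ (x * h) = σ x * φ h := by
    have hx : ((x * h : A) : A ⧸ H₁) = x := QuotientGroup.mk_mul_of_mem x h.2
    have hr : r (x * h) = r x * h := Subtype.ext (by simp [r, hx, mul_assoc])
    simp [σ, hx, hr, mul_assoc]
  have hmk (x : A) : (σ x : A ⧸ H₂) = e x := by
    rw [QuotientGroup.mk_mul_of_mem _ (φ (r x)).2, QuotientGroup.out_eq']
  have hinj : Function.Injective σ := by
    intro x y hxy
    have hq : (x : A ⧸ H₁) = y := e.injective (by rw [← hmk, ← hmk, hxy])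
    have hr : r x = r y := by simpa [σ, hq] using hxy
    simpa [r, hq] using hr
  let σ' : Equiv.Perm A := .ofBijective σ (Finite.injective_iff_bijective.1 hinj)
  refine ⟨(Equiv.inv A).trans (σ'.trans (Equiv.inv A)), fun h x => ?_⟩
  have := hσ x⁻¹ h⁻¹
  simp_all [σ']

theorem mk_inv_mul (h : H₁) (x : A) : (((h * x : A)⁻¹ : A) : A ⧸ H₁) = (x⁻¹ : A) := by
  rw [mul_inv_rev]
  exact QuotientGroup.mk_mul_of_mem _ (inv_mem h.2)

theorem schreier_mul {τ : Equiv.Perm A} (hτ : ∀ (h : H₁) (x : A), τ (h * x) = φ h * τ x)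
    (h : H₁) (x : A) :
    (of (τ (h * x)))⁻¹ * t * of (h * x) =
      ((of (τ x))⁻¹ * t * of x : HNNExtension A H₁ H₂ φ) := by
  rw [hτ, map_mul, map_mul, mul_inv_rev, mul_assoc, mul_assoc, ← mul_assoc t, t_mul_of]
  group

section

variable (τ : Equiv.Perm A) (hτ : ∀ (h : H₁) (x : A), τ (h * x) = φ h * τ x)

/-- The action of the HNN extension on `A × FreeGroup (A ⧸ H₁)` in which `A` acts by left
multiplication on `A`, and `t` acts as `τ` on `A` while recording the coset it passes through. -/
def permHom : HNNExtension A H₁ H₂ φ →* Equiv.Perm (A × FreeGroup (A ⧸ H₁)) :=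
  lift
    { toFun a := (Equiv.mulLeft a).prodCongr (Equiv.refl _)
      map_one' := by ext p <;> simp
      map_mul' a b := by ext p <;> simp [mul_assoc] }
    (Equiv.prodShear τ fun x => Equiv.mulLeft (FreeGroup.of ((x⁻¹ : A) : A ⧸ H₁)))
    fun h => Equiv.ext fun p => Prod.ext (hτ h p.1)
      (congrArg (FreeGroup.of · * p.2) (mk_inv_mul h p.1))

@[simp]
theorem permHom_of (a : A) (p : A × FreeGroup (A ⧸ H₁)) :
    permHom τ hτ (of a) p = (a * p.1, p.2) := by
  simp [permHom, Prod.map]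

@[simp]
theorem permHom_t (p : A × FreeGroup (A ⧸ H₁)) :
    permHom τ hτ t p = (τ p.1, FreeGroup.of ((p.1⁻¹ : A) : A ⧸ H₁) * p.2) := by
  simp [permHom]

/-- The homomorphism sending the coset of `x⁻¹` to the Schreier generator `(τ x)⁻¹ t x`. -/
def freeHom : FreeGroup (A ⧸ H₁) →* HNNExtension A H₁ H₂ φ :=
  FreeGroup.lift fun q => Quotient.liftOn' q (fun x => (of (τ x⁻¹))⁻¹ * t * of x⁻¹) <| by
    intro x y hxy
    have h := schreier_mul hτ ⟨x⁻¹ * y, QuotientGroup.leftRel_apply.1 hxy⟩ y⁻¹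
    simpa using h

theorem freeHom_of (x : A) :
    freeHom τ hτ (FreeGroup.of ((x⁻¹ : A) : A ⧸ H₁)) = (of (τ x))⁻¹ * t * of x := by
  rw [freeHom, FreeGroup.lift_apply_of]
  change (of (τ x⁻¹⁻¹))⁻¹ * t * of x⁻¹⁻¹ = _
  rw [inv_inv]

theorem permHom_freeHom (l m : FreeGroup (A ⧸ H₁)) :
    permHom τ hτ (freeHom τ hτ l) (1, m) = (1, l * m) := by
  have hof (q : A ⧸ H₁) (m : FreeGroup (A ⧸ H₁)) :
      permHom τ hτ (freeHom τ hτ (.of q)) (1, m) = (1, .of q * m) := by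
    obtain ⟨y, rfl⟩ := QuotientGroup.mk_surjective q
    obtain ⟨x, rfl⟩ := inv_surjective y
    rw [freeHom_of, mul_assoc, map_mul, map_inv, Equiv.Perm.mul_apply, Equiv.Perm.inv_eq_iff_eq]
    simp
  induction l generalizing m with
  | C1 => simp
  | of q => exact hof q m
  | inv_of q _ =>
    rw [map_inv, map_inv, Equiv.Perm.inv_eq_iff_eq, hof, mul_inv_cancel_left]
  | mul l₁ l₂ ih₁ ih₂ => simp [ih₁, ih₂, mul_assoc]

theorem freeHom_injective : Function.Injective (freeHom τ hτ) := by
  intro l m hlm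
  have h := permHom_freeHom τ hτ l 1
  rw [hlm, permHom_freeHom] at h
  simpa using h.symm

theorem of_mul_freeHom_permHom (g : HNNExtension A H₁ H₂ φ) (p : A × FreeGroup (A ⧸ H₁)) :
    of (permHom τ hτ g p).1 * freeHom τ hτ (permHom τ hτ g p).2 =
      g * (of p.1 * freeHom τ hτ p.2) := by
  induction g using induction_on generalizing p with
  | of a => simp [mul_assoc]
  | t => simp [freeHom_of, mul_assoc]
  | mul g₁ g₂ ih₁ ih₂ => simp [ih₁, ih₂, mul_assoc]
  | inv g ih =>
    have h := ih (permHom τ hτ g⁻¹ p)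
    rw [← Equiv.Perm.mul_apply, ← map_mul, mul_inv_cancel, map_one, Equiv.Perm.one_apply] at h
    rw [h, inv_mul_cancel_left]

theorem index_range_freeHom_ne_zero [Finite A] : (freeHom τ hτ).range.index ≠ 0 := by
  have hsurj : Function.Surjective
      fun a : A => ((of a : HNNExtension A H₁ H₂ φ) : _ ⧸ (freeHom τ hτ).range) := by
    intro q
    obtain ⟨g, rfl⟩ := QuotientGroup.mk_surjective q
    have h := of_mul_freeHom_permHom τ hτ g 1
    refine ⟨(permHom τ hτ g 1).1, QuotientGroup.eq.2 ⟨(permHom τ hτ g 1).2, ?_⟩⟩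
    rw [eq_inv_mul_iff_mul_eq, h]
    simp
  have := Finite.of_surjective _ hsurj
  exact Subgroup.index_ne_zero_of_finite

end

end HNNExtension

/-- The HNN extension `G = ⟨A, t | t h t⁻¹ = φ(h), h ∈ H₁⟩` of a finite group `A`
relative to an isomorphism `φ : H₁ ≃* H₂` between two subgroups of `A` has a free
subgroup of finite index. -/
theorem hnnExtension_of_finite_group_has_free_subgroup_of_finite_index
    (A : Type*) [Group A] [Finite A] (H₁ H₂ : Subgroup A) (φ : H₁ ≃* H₂) :
    ∃ F : Subgroup (HNNExtension A H₁ H₂ φ), F.index ≠ 0 ∧ IsFreeGroup F := by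
  obtain ⟨τ, hτ⟩ := HNNExtension.exists_perm_mul_eq_mul φ
  exact ⟨(HNNExtension.freeHom τ hτ).range, HNNExtension.index_range_freeHom_ne_zero τ hτ,
    .ofMulEquiv (MonoidHom.ofInjective (HNNExtension.freeHom_injective τ hτ))⟩
end
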